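/- Monotone decrease of the ergotropy ratio (Eq. 43). Let r₀ ∈ [0,1], Γ ≥ 0 and c ≥ 1 be real numbers, and define the output ergotropy ratio r̄ := r₀ + (1 − r₀) · (1 − √(1 + 4Γc + 4Γ²)/(1 + 2(1 − r₀)Γ)). Then r̄ ≤ r₀/(1 + 2(1 − r₀)Γ) ≤ r₀. In particular the output ergotropy ratio never exceeds its initial value r₀. -/

import Mathlib

/-- Monotone decrease of the ergotropy ratio (Eq. 43): for `r₀ ∈ [0,1]`, `Γ ≥ 0`, `c ≥ 1`,
the output ergotropy ratio
`r̄ = r₀ + (1 - r₀)(1 - √(1 + 4Γc + 4Γ²)/(1 + 2(1 - r₀)Γ))`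
satisfies `r̄ ≤ r₀/(1 + 2(1 - r₀)Γ) ≤ r₀`. -/
theorem ergotropy_ratio_decreases
    (r₀ Γ c : ℝ) (hr₀ : 0 ≤ r₀) (hr₁ : r₀ ≤ 1) (hΓ : 0 ≤ Γ) (hc : 1 ≤ c) :
    r₀ + (1 - r₀) *
        (1 - Real.sqrt (1 + 4 * Γ * c + 4 * Γ ^ 2) / (1 + 2 * (1 - r₀) * Γ)) ≤
      r₀ / (1 + 2 * (1 - r₀) * Γ) ∧
    r₀ / (1 + 2 * (1 - r₀) * Γ) ≤ r₀ := by
  have hD : 1 ≤ 1 + 2 * (1 - r₀) * Γ := by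
    nlinarith [mul_nonneg (sub_nonneg.2 hr₁) hΓ]
  have hD₀ : 0 < 1 + 2 * (1 - r₀) * Γ := by linarith
  have hS : 1 + 2 * Γ ≤ Real.sqrt (1 + 4 * Γ * c + 4 * Γ ^ 2) := by
    apply Real.le_sqrt_of_sq_le
    nlinarith [mul_nonneg hΓ (sub_nonneg.2 hc)]
  refine ⟨?_, div_le_self hr₀ hD⟩
  rw [le_div_iff₀ hD₀]
  calc _ = 1 + 2 * (1 - r₀) * Γ
          - (1 - r₀) * Real.sqrt (1 + 4 * Γ * c + 4 * Γ ^ 2) := by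
        linear_combination (r₀ - 1) *
          div_mul_cancel₀ (Real.sqrt (1 + 4 * Γ * c + 4 * Γ ^ 2)) hD₀.ne'
    _ ≤ r₀ := by
        linarith [mul_le_mul_of_nonneg_left hS (sub_nonneg.2 hr₁)]
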